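/- For every ε > 0 there exists a constant C_ε > 0, depending only on ε, such that for every integer N ≥ 2, every T > 0 and every solution φ of the spectral collocation approximation of the elasticity system, |∫₀^T ∫_Ω ( Σ_{i ∈ I_{Γ₁}} (μ ∂²φ/∂ν² + (λ+μ) ν ∂(div φ)/∂ν)(t, P_i) Ψ_i(x) ) · ( m_j ∂φ/∂x_j )(t,x) dx dt| ≤ C_ε ω_N ∫₀^T ∫_{Γ₁} |μ ∂²φ/∂ν² + (λ+μ) ν ∂(div φ)/∂ν|² dγ dt + (8d/μ) ε T E(0), where ω_N = 2/(N(N+1)), m(x) = x − (−1,…,−1), and a repeated index j denotes summation over j = 1,…,d. -/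

import Mathlib

open MeasureTheory Polynomial Finset
open scoped Classical

noncomputable section

/-- Points of `ℝ^d`. -/
abbrev Vec (d : ℕ) := Fin d → ℝ

/-- The open cube `Ω = (-1,1)^d`. -/
def cubeO (d : ℕ) : Set (Vec d) := Set.univ.pi fun _ => Set.Ioo (-1 : ℝ) 1

/-- The closed cube `cl(Ω) = [-1,1]^d`. -/
def cubeC (d : ℕ) : Set (Vec d) := Set.univ.pi fun _ => Set.Icc (-1 : ℝ) 1

/-- The boundary `∂Ω` of the cube. -/
def cubeB (d : ℕ) : Set (Vec d) := cubeC d \ cubeO d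

/-- The Legendre polynomial `L_N` via Rodrigues' formula. -/
def legendre (N : ℕ) : Polynomial ℝ :=
  C (1 / (2 ^ N * (N.factorial : ℝ))) * derivative^[N] ((X ^ 2 - 1) ^ N)

/-- `nd` is the increasing enumeration of the `N+1` Legendre–Gauss–Lobatto nodes,
which are exactly the roots of `(1 - x²) L_N'(x)`. -/
def IsLGL (N : ℕ) (nd : Fin (N + 1) → ℝ) : Prop :=
  StrictMono nd ∧ nd 0 = -1 ∧ nd (Fin.last N) = 1 ∧
    ∀ x : ℝ, (1 - x ^ 2) * (derivative (legendre N)).eval x = 0 ↔ ∃ k, nd k = x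

/-- `Ψ` is the family of Lagrange basis polynomials of degree `N` at the nodes `nd`. -/
def IsLagrange (N : ℕ) (nd : Fin (N + 1) → ℝ) (Ψ : Fin (N + 1) → Polynomial ℝ) : Prop :=
  ∀ k, (Ψ k).natDegree ≤ N ∧ ∀ m, (Ψ k).eval (nd m) = if m = k then 1 else 0

/-- The LGL quadrature weight `ω_k = ∫_{-1}^1 Ψ_k`. -/
def lglW (N : ℕ) (Ψ : Fin (N + 1) → Polynomial ℝ) (k : Fin (N + 1)) : ℝ :=
  ∫ x in (-1 : ℝ)..(1 : ℝ), (Ψ k).eval x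

/-- The tensor-product collocation node `P_i` associated with a multi-index. -/
def nodeP {N d : ℕ} (nd : Fin (N + 1) → ℝ) (k : Fin d → Fin (N + 1)) : Vec d :=
  fun j => nd (k j)

/-- `p : ℝ^d → ℝ` is (the function associated with) a polynomial of degree at most `N`
in each of the `d` variables, i.e. a member of `P_N(Ω)`. -/
def MemPolyN (d N : ℕ) (p : Vec d → ℝ) : Prop :=
  ∃ q : MvPolynomial (Fin d) ℝ, (∀ j, q.degreeOf j ≤ N) ∧ ∀ x, MvPolynomial.eval x q = p x

/-- Membership in `P_N^{Di}(Ω)`: a polynomial of degree `≤ N` in each variable vanishing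
on `∂Ω`. -/
def MemPolyDi (d N : ℕ) (p : Vec d → ℝ) : Prop :=
  MemPolyN d N p ∧ ∀ x ∈ cubeB d, p x = 0

/-- Partial derivative `∂f/∂x_j`. -/
def pd {d : ℕ} (j : Fin d) (f : Vec d → ℝ) (x : Vec d) : ℝ :=
  fderiv ℝ f x (Pi.single j 1)

/-- Divergence of a vector field. -/
def vdiv {d : ℕ} (v : Vec d → Fin d → ℝ) (x : Vec d) : ℝ :=
  ∑ j, pd j (fun y => v y j) x

/-- The elasticity operator `Δ* = μΔ + (λ+μ)∇div` acting on vector fields. -/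
def elast {d : ℕ} (lam mu : ℝ) (v : Vec d → Fin d → ℝ) (x : Vec d) (i : Fin d) : ℝ :=
  mu * ∑ j, pd j (pd j fun y => v y i) x + (lam + mu) * pd i (vdiv v) x

/-- Time derivative of a time-dependent vector field. -/
def tderiv {d : ℕ} (φ : ℝ → Vec d → Fin d → ℝ) : ℝ → Vec d → Fin d → ℝ :=
  fun t x i => deriv (fun s => φ s x i) t

/-- `φ` is a solution of the spectral collocation approximation of the elasticity system:
`φ ∈ C^∞([0,T]; P_N(Ω)^d)`, `φ_tt(t,P_i) = Δ*φ(t,P_i)` at interior collocation nodes and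
`φ(t,P_i) = 0` at boundary collocation nodes. -/
def IsColloc (d N : ℕ) (lam mu T : ℝ) (nd : Fin (N + 1) → ℝ)
    (φ : ℝ → Vec d → Fin d → ℝ) : Prop :=
  (∀ x i, ContDiff ℝ (⊤ : ℕ∞) fun t => φ t x i) ∧
  (∀ t ∈ Set.Icc (0 : ℝ) T, ∀ i, MemPolyN d N fun x => φ t x i) ∧
  (∀ t ∈ Set.Icc (0 : ℝ) T, ∀ k : Fin d → Fin (N + 1), nodeP nd k ∈ cubeO d →
    ∀ i, tderiv (tderiv φ) t (nodeP nd k) i = elast lam mu (φ t) (nodeP nd k) i) ∧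
  (∀ t ∈ Set.Icc (0 : ℝ) T, ∀ k : Fin d → Fin (N + 1), nodeP nd k ∈ cubeB d →
    ∀ i, φ t (nodeP nd k) i = 0)

/-- The discrete (LGL) inner product `(w,z)_N = Σ_i ω_i w(P_i) z(P_i)`. -/
def dInner (N d : ℕ) (nd : Fin (N + 1) → ℝ) (Ψ : Fin (N + 1) → Polynomial ℝ)
    (w z : Vec d → ℝ) : ℝ :=
  ∑ k : Fin d → Fin (N + 1), (∏ j, lglW N Ψ (k j)) * (w (nodeP nd k) * z (nodeP nd k))

/-- The discrete energy
`E(t) = ½(‖φ_t‖_N² + μ‖∇φ‖_N² + (λ+μ)‖div φ‖_N²)` of a collocation solution. -/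
def dEnergy (d N : ℕ) (lam mu : ℝ) (nd : Fin (N + 1) → ℝ) (Ψ : Fin (N + 1) → Polynomial ℝ)
    (φ : ℝ → Vec d → Fin d → ℝ) (t : ℝ) : ℝ :=
  (1 / 2) * ((∑ i, dInner N d nd Ψ (fun x => tderiv φ t x i) fun x => tderiv φ t x i) +
    mu * ∑ i, ∑ j, dInner N d nd Ψ (pd j fun y => φ t y i) (pd j fun y => φ t y i) +
    (lam + mu) * dInner N d nd Ψ (vdiv (φ t)) (vdiv (φ t)))

/-- Surface integral over the face `{x ∈ ∂Ω : x_j = c}` (with `c = ±1`) of the cube: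
the integrand does not depend on the `j`-th variable after the substitution, so the
integral over the full cube divided by `2` is exactly the `(d-1)`-dimensional integral. -/
def faceInt (d : ℕ) (j : Fin d) (c : ℝ) (f : Vec d → ℝ) : ℝ :=
  (1 / 2) * ∫ x in cubeC d, f (Function.update x j c)

/-- The `i`-th component of `μ ∂v/∂ν + (λ+μ) ν div v` on the face with outward normal
`ν = c·e_j`. -/
def obs1 {d : ℕ} (lam mu : ℝ) (v : Vec d → Fin d → ℝ) (j : Fin d) (c : ℝ) (x : Vec d)
    (i : Fin d) : ℝ :=
  mu * (c * pd j (fun y => v y i) x) +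
    (lam + mu) * (c * if i = j then 1 else 0) * vdiv v x

/-- The `i`-th component of `μ ∂²v/∂ν² + (λ+μ) ν ∂(div v)/∂ν` on the face with outward
normal `ν = c·e_j`. -/
def obs2 {d : ℕ} (lam mu : ℝ) (v : Vec d → Fin d → ℝ) (j : Fin d) (c : ℝ) (x : Vec d)
    (i : Fin d) : ℝ :=
  mu * (c * (c * pd j (pd j fun y => v y i) x)) +
    (lam + mu) * (c * if i = j then 1 else 0) * (c * pd j (vdiv v) x)

/-- Integration over `(-1, 1)` as a linear functional on polynomials. -/
def polyInt : ℝ[X] →ₗ[ℝ] ℝ where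
  toFun p := ∫ x in (-1 : ℝ)..1, p.eval x
  map_add' p q := by
    simp only [eval_add]
    exact intervalIntegral.integral_add (p.continuous.intervalIntegrable _ _)
      (q.continuous.intervalIntegrable _ _)
  map_smul' a p := by
    simp only [eval_smul, smul_eq_mul, RingHom.id_apply]
    exact intervalIntegral.integral_const_mul _ _

lemma polyInt_apply (p : ℝ[X]) : polyInt p = ∫ x in (-1 : ℝ)..1, p.eval x := rfl

lemma polyInt_derivative (p : ℝ[X]) : polyInt (derivative p) = p.eval 1 - p.eval (-1) :=
  intervalIntegral.integral_eq_sub_of_hasDerivAt (fun x _ => p.hasDerivAt x)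
    (p.derivative.continuous.intervalIntegrable _ _)

lemma polyInt_C_mul (a : ℝ) (p : ℝ[X]) : polyInt (C a * p) = a * polyInt p := by
  rw [← smul_eq_C_mul, map_smul, smul_eq_mul]

lemma polyInt_mul_self_nonneg (p : ℝ[X]) : 0 ≤ polyInt (p * p) :=
  intervalIntegral.integral_nonneg (by norm_num) fun x _ => by
    rw [eval_mul]; exact mul_self_nonneg _

lemma eval_iterate_derivative_eq_zero {N m : ℕ} (h : m < N) {x : ℝ} (hx : x ^ 2 = 1) :
    (derivative^[m] ((X ^ 2 - 1 : ℝ[X]) ^ N)).eval x = 0 := by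
  obtain ⟨r, hr⟩ := pow_sub_dvd_iterate_derivative_pow (X ^ 2 - 1 : ℝ[X]) N m
  rw [hr]
  simp [hx, Nat.sub_ne_zero_of_lt h]

lemma polyInt_iterate_derivative_mul (N m : ℕ) (hm : m ≤ N) (q : ℝ[X]) (hq : q.degree < m) :
    polyInt (derivative^[m] ((X ^ 2 - 1 : ℝ[X]) ^ N) * q) = 0 := by
  induction m generalizing q with
  | zero =>
    have : q = 0 := by simpa using hq
    simp [this]
  | succ m ih =>
    by_cases hq0 : q = 0
    · simp [hq0]
    have h1 := polyInt_derivative (derivative^[m] ((X ^ 2 - 1 : ℝ[X]) ^ N) * q)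
    rw [derivative_mul, map_add, eval_mul, eval_mul,
      eval_iterate_derivative_eq_zero (by omega) (by norm_num),
      eval_iterate_derivative_eq_zero (by omega) (by norm_num),
      ih (by omega) (derivative q) ?_] at h1
    · rw [Function.iterate_succ_apply']
      simpa using h1
    · refine (degree_derivative_lt hq0).trans_le ?_
      exact degree_le_of_natDegree_le
        (Nat.lt_succ_iff.1 ((natDegree_lt_iff_degree_lt hq0).2 (by exact_mod_cast hq)))

lemma polyInt_legendre_mul (N : ℕ) (q : ℝ[X]) (hq : q.degree < N) :
    polyInt (legendre N * q) = 0 := by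
  rw [legendre, mul_assoc, polyInt_C_mul, polyInt_iterate_derivative_mul N N le_rfl q hq, mul_zero]

/-- The polynomial `(1 - x²) L_N'(x)`, whose roots are the LGL nodes. -/
def lobatto (N : ℕ) : ℝ[X] := (1 - X ^ 2) * derivative (legendre N)

lemma polyInt_lobatto_mul {N : ℕ} (q : ℝ[X]) (hq : q.natDegree + 2 ≤ N) :
    polyInt (lobatto N * q) = 0 := by
  have h1 := polyInt_derivative ((1 - X ^ 2) * q * legendre N)
  have h2 : derivative ((1 - X ^ 2) * q * legendre N) =
      legendre N * derivative ((1 - X ^ 2) * q) + lobatto N * q := by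
    rw [derivative_mul, lobatto]; ring
  rw [h2, map_add, polyInt_legendre_mul] at h1
  · simpa using h1
  · have h3 : ((1 - X ^ 2 : ℝ[X]) * q).natDegree ≤ N := by
      refine natDegree_mul_le.trans ?_
      have : (1 - X ^ 2 : ℝ[X]).natDegree ≤ 2 := by compute_degree
      omega
    refine lt_of_le_of_lt degree_le_natDegree ?_
    have := natDegree_derivative_le ((1 - X ^ 2 : ℝ[X]) * q)
    exact_mod_cast (by omega : (derivative ((1 - X ^ 2 : ℝ[X]) * q)).natDegree < N)

lemma natDegree_derivative_legendre_le (N : ℕ) :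
    (derivative (legendre N)).natDegree ≤ N - 1 := by
  refine (natDegree_derivative_le _).trans (Nat.sub_le_sub_right ?_ 1)
  refine (natDegree_C_mul_le _ _).trans ((natDegree_iterate_derivative _ _).trans ?_)
  have : ((X ^ 2 - 1 : ℝ[X]) ^ N).natDegree ≤ N * 2 :=
    natDegree_pow_le_of_le N (by compute_degree)
  omega

section LGL

variable {N : ℕ} {nd : Fin (N + 1) → ℝ} {Ψ : Fin (N + 1) → ℝ[X]}

lemma IsLGL.eval_lobatto (h : IsLGL N nd) (k : Fin (N + 1)) : (lobatto N).eval (nd k) = 0 := by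
  have := (h.2.2.2 (nd k)).2 ⟨k, rfl⟩
  simpa [lobatto] using this

lemma IsLGL.lobatto_ne_zero (h : IsLGL N nd) : lobatto N ≠ 0 := by
  intro h0
  refine Set.infinite_univ (α := ℝ) ((Set.finite_range nd).subset fun x _ => ?_)
  refine (h.2.2.2 x).1 ?_
  have : (lobatto N).eval x = 0 := by rw [h0, eval_zero]
  simpa [lobatto] using this

lemma IsLGL.natDegree_lobatto (h : IsLGL N nd) (hN : 2 ≤ N) : (lobatto N).natDegree = N + 1 := by
  apply le_antisymm
  · refine natDegree_mul_le.trans ?_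
    have h1 : (1 - X ^ 2 : ℝ[X]).natDegree ≤ 2 := by compute_degree
    have h2 := natDegree_derivative_legendre_le N
    omega
  · have := card_le_degree_of_subset_roots (p := lobatto N) (Z := univ.image nd) (by
      intro x hx
      obtain ⟨k, -, rfl⟩ := Finset.mem_image.1 (show x ∈ univ.image nd from hx)
      exact (mem_roots h.lobatto_ne_zero).2 (h.eval_lobatto k))
    rwa [card_image_of_injective _ h.1.injective, card_univ, Fintype.card_fin] at this

lemma eq_sum_lagrange (h : IsLGL N nd) (hΨ : IsLagrange N nd Ψ) {p : ℝ[X]}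
    (hp : p.natDegree ≤ N) : p = ∑ k, C (p.eval (nd k)) * Ψ k := by
  refine eq_of_degree_sub_lt_of_eval_index_eq (v := nd) univ h.1.injective.injOn ?_ ?_
  · rw [card_univ, Fintype.card_fin]
    refine lt_of_le_of_lt degree_le_natDegree ?_
    have : (p - ∑ k, C (p.eval (nd k)) * Ψ k).natDegree ≤ N :=
      (natDegree_sub_le_of_le hp (natDegree_sum_le_of_forall_le _ _ fun k _ =>
        (natDegree_C_mul_le _ _).trans (hΨ k).1)).trans (max_self N).le
    exact_mod_cast Nat.lt_succ_of_le this
  · intro m _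
    simp [eval_finsetSum, (hΨ _).2]

lemma eval_eq_sum_lagrange (h : IsLGL N nd) (hΨ : IsLagrange N nd Ψ) {p : ℝ[X]}
    (hp : p.natDegree ≤ N) (x : ℝ) : p.eval x = ∑ k, p.eval (nd k) * (Ψ k).eval x := by
  conv_lhs => rw [eq_sum_lagrange h hΨ hp]
  simp [eval_finsetSum]

lemma polyInt_eq_quadrature_of_le (h : IsLGL N nd) (hΨ : IsLagrange N nd Ψ) {p : ℝ[X]}
    (hp : p.natDegree ≤ N) : polyInt p = ∑ k, lglW N Ψ k * p.eval (nd k) := by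
  conv_lhs => rw [eq_sum_lagrange h hΨ hp]
  rw [map_sum]
  refine sum_congr rfl fun k _ => ?_
  rw [polyInt_C_mul, mul_comm, polyInt_apply, lglW]

/-- LGL quadrature is exact up to degree `2N - 1`. -/
lemma polyInt_eq_quadrature (h : IsLGL N nd) (hN : 2 ≤ N) (hΨ : IsLagrange N nd Ψ) {p : ℝ[X]}
    (hp : p.natDegree + 1 ≤ 2 * N) : polyInt p = ∑ k, lglW N Ψ k * p.eval (nd k) := by
  have hQ := h.natDegree_lobatto hN
  have hdm := EuclideanDomain.div_add_mod p (lobatto N)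
  have hr : (p % lobatto N).natDegree ≤ N := by
    have := natDegree_mod_lt p (q := lobatto N) (by omega)
    omega
  have hq : (p / lobatto N).natDegree + 2 ≤ N := by
    by_cases h0 : p / lobatto N = 0
    · rw [h0, natDegree_zero]
      omega
    have hp0 : p ≠ 0 := by
      rintro rfl
      exact h0 EuclideanDomain.zero_div
    have hle : (lobatto N).degree ≤ p.degree := by
      by_contra hlt
      exact h0 ((Polynomial.div_eq_zero_iff h.lobatto_ne_zero).2 (not_le.1 hlt))
    have hdeg := degree_add_div h.lobatto_ne_zero hle
    rw [degree_eq_natDegree h.lobatto_ne_zero, degree_eq_natDegree h0,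
      degree_eq_natDegree hp0] at hdeg
    have : (lobatto N).natDegree + (p / lobatto N).natDegree = p.natDegree := by
      exact_mod_cast hdeg
    omega
  conv_lhs => rw [← hdm]
  rw [map_add, polyInt_lobatto_mul _ hq, zero_add, polyInt_eq_quadrature_of_le h hΨ hr]
  refine sum_congr rfl fun k _ => ?_
  conv_rhs => rw [← hdm]
  rw [eval_add, eval_mul, h.eval_lobatto, zero_mul, zero_add]


lemma eval_iterate_derivative_one (N n : ℕ) :
    (derivative^[N + n] ((X ^ 2 - 1 : ℝ[X]) ^ N)).eval 1 =
      (N + n).factorial * (2 ^ (N - n) * N.choose n) := by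
  rw [← factorial_smul_hasseDeriv, LinearMap.smul_apply, eval_smul, ← taylor_coeff, nsmul_eq_mul]
  congr 1
  have : taylor 1 ((X ^ 2 - 1 : ℝ[X]) ^ N) = X ^ N * (X + C 2) ^ N := by
    rw [taylor_apply, ← mul_pow]
    simp only [pow_comp, sub_comp, X_comp, one_comp]
    congr 1
    rw [map_one, map_ofNat]
    ring
  rw [this, add_comm N n, coeff_X_pow_mul, coeff_X_add_C_pow]

lemma legendre_eval_one (N : ℕ) : (legendre N).eval 1 = 1 := by
  have h := eval_iterate_derivative_one N 0
  have h2 : (N.factorial : ℝ) ≠ 0 := by positivity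
  rw [legendre, eval_mul, eval_C]
  simp only [add_zero, Nat.sub_zero, Nat.choose_zero_right, Nat.cast_one, mul_one] at h
  rw [h]
  field_simp

lemma derivative_legendre_eval_one {N : ℕ} (hN : 1 ≤ N) :
    (derivative (legendre N)).eval 1 = N * (N + 1) / 2 := by
  have h := eval_iterate_derivative_one N 1
  obtain ⟨n, rfl⟩ := Nat.exists_eq_add_of_le' hN
  have h2 : ((n + 1).factorial : ℝ) ≠ 0 := by positivity
  rw [legendre, derivative_C_mul, ← Function.iterate_succ_apply' derivative, eval_mul, eval_C, h,
    Nat.factorial_succ (n + 1)]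
  simp only [add_tsub_cancel_right, Nat.choose_one_right]
  push_cast
  field_simp
  ring

lemma lglW_last (h : IsLGL N nd) (hN : 2 ≤ N) (hΨ : IsLagrange N nd Ψ) :
    lglW N Ψ (Fin.last N) = 2 / (N * (N + 1)) := by
  set p : ℝ[X] := (1 + X) * derivative (legendre N) with hp
  have hdeg : p.natDegree ≤ N := by
    refine natDegree_mul_le.trans ?_
    have h1 : (1 + X : ℝ[X]).natDegree ≤ 1 := by compute_degree
    have h2 := natDegree_derivative_legendre_le N
    omega
  have h1 : polyInt p = 2 := by
    have := polyInt_derivative ((1 + X) * legendre N)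
    have h0 : polyInt (legendre N) = 0 := by
      have := polyInt_legendre_mul N 1 (by rw [degree_one]; exact_mod_cast (by omega : 0 < N))
      rwa [mul_one] at this
    rw [derivative_mul, map_add] at this
    simp only [derivative_add, derivative_one, derivative_X, zero_add, one_mul, h0, eval_mul,
      eval_add, eval_one, eval_X, legendre_eval_one] at this
    rw [hp, this]
    norm_num
  rw [polyInt_eq_quadrature_of_le h hΨ hdeg, sum_eq_single (Fin.last N), h.2.2.1] at h1
  · simp only [hp, eval_mul, eval_add, eval_one, eval_X,
      derivative_legendre_eval_one (show 1 ≤ N by omega)] at h1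
    have : (N : ℝ) ≠ 0 := by positivity
    field_simp
    linarith
  · intro k _ hk
    have h2 := h.eval_lobatto k
    have h3 : nd k ≠ 1 := fun h3 => hk (h.1.injective (h3.trans h.2.2.1.symm))
    have h4 : (1 - nd k) * p.eval (nd k) = 0 := by
      rw [← h2]
      simp only [hp, lobatto, eval_mul, eval_add, eval_sub, eval_pow, eval_one, eval_X]
      ring
    rw [(mul_eq_zero.1 h4).resolve_left (sub_ne_zero.2 h3.symm), mul_zero]
  · simp

/-- The defect of LGL quadrature on products of Lagrange polynomials is a nonnegative
rank-one form. -/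
lemma exists_quadrature_defect (h : IsLGL N nd) (hN : 2 ≤ N) (hΨ : IsLagrange N nd Ψ) :
    ∃ κ : ℝ, 0 ≤ κ ∧ ∀ a b, (if a = b then lglW N Ψ a else 0) =
      polyInt (Ψ a * Ψ b) + κ * ((Ψ a).coeff N * (Ψ b).coeff N) := by
  set L' := derivative (legendre N)
  set b := L'.coeff (N - 1) with hb
  have hL' : L'.natDegree ≤ N - 1 := natDegree_derivative_legendre_le N
  have hlob : (lobatto N).coeff (N + 1) = -b := by
    rw [lobatto, show N + 1 = 2 + (N - 1) by omega,
      coeff_mul_add_eq_of_natDegree_le (by compute_degree) hL']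
    simp [coeff_one, hb, L']
  have hb0 : b ≠ 0 := by
    intro h0
    rw [h0, neg_zero, ← h.natDegree_lobatto hN] at hlob
    exact h.lobatto_ne_zero (leadingCoeff_eq_zero.1 hlob)
  set W := lobatto N * L' with hW
  have hWdeg : W.natDegree ≤ 2 * N := by
    have : W.natDegree ≤ _ := natDegree_mul_le
    have := h.natDegree_lobatto hN
    omega
  have hWc : W.coeff (2 * N) = -b ^ 2 := by
    rw [hW, show 2 * N = (N + 1) + (N - 1) by omega,
      coeff_mul_add_eq_of_natDegree_le (h.natDegree_lobatto hN).le hL', hlob]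
    ring
  have hWint : 0 ≤ polyInt W := by
    refine intervalIntegral.integral_nonneg (by norm_num) fun x hx => ?_
    simp only [hW, lobatto, eval_mul, eval_sub, eval_pow, eval_one, eval_X]
    have : 0 ≤ 1 - x ^ 2 := by nlinarith [hx.1, hx.2]
    rw [mul_assoc]
    exact mul_nonneg this (mul_self_nonneg _)
  refine ⟨polyInt W / b ^ 2, by positivity, fun i j => ?_⟩
  set s := (Ψ i).coeff N * (Ψ j).coeff N with hs
  have hf : (Ψ i * Ψ j + C (s / b ^ 2) * W).natDegree ≤ 2 * N - 1 := by
    rw [natDegree_le_iff_coeff_eq_zero]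
    intro m hm
    rcases eq_or_lt_of_le (show 2 * N ≤ m by omega) with rfl | hm'
    · rw [coeff_add, coeff_C_mul, hWc, two_mul,
        coeff_mul_add_eq_of_natDegree_le (hΨ i).1 (hΨ j).1, ← hs]
      field_simp
      ring
    · refine coeff_eq_zero_of_natDegree_lt (lt_of_le_of_lt ?_ hm')
      refine natDegree_add_le_of_degree_le ?_ ((natDegree_C_mul_le _ _).trans hWdeg)
      have := natDegree_mul_le (p := Ψ i) (q := Ψ j)
      have := (hΨ i).1
      have := (hΨ j).1
      omega
  have h1 := polyInt_eq_quadrature h hN hΨ (p := Ψ i * Ψ j + C (s / b ^ 2) * W) (by omega)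
  rw [map_add, polyInt_C_mul] at h1
  have h2 : ∀ k, (Ψ i * Ψ j + C (s / b ^ 2) * W).eval (nd k) =
      if k = i then (if i = j then 1 else 0) else 0 := by
    intro k
    rw [eval_add, eval_mul, eval_mul, hW, eval_mul, h.eval_lobatto, (hΨ i).2, (hΨ j).2]
    by_cases hk : k = i
    · subst hk
      simp
    · simp [hk]
  simp only [h2] at h1
  rw [show polyInt W / b ^ 2 * s = s / b ^ 2 * polyInt W by ring, h1]
  simp

lemma lglW_nonneg (h : IsLGL N nd) (hN : 2 ≤ N) (hΨ : IsLagrange N nd Ψ) (k : Fin (N + 1)) :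
    0 ≤ lglW N Ψ k := by
  obtain ⟨κ, hκ, H⟩ := exists_quadrature_defect h hN hΨ
  have h1 := H k k
  rw [if_pos rfl] at h1
  rw [h1]
  exact add_nonneg (polyInt_mul_self_nonneg _) (mul_nonneg hκ (mul_self_nonneg _))

lemma polyInt_last_mul_last_le (h : IsLGL N nd) (hN : 2 ≤ N) (hΨ : IsLagrange N nd Ψ) :
    polyInt (Ψ (Fin.last N) * Ψ (Fin.last N)) ≤ 2 / (N * (N + 1)) := by
  obtain ⟨κ, hκ, H⟩ := exists_quadrature_defect h hN hΨ
  have h1 := H (Fin.last N) (Fin.last N)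
  rw [if_pos rfl, lglW_last h hN hΨ] at h1
  rw [h1]
  exact le_add_of_nonneg_right (mul_nonneg hκ (mul_self_nonneg _))

/-- Summation by parts for the differentiation matrix at the LGL nodes. -/
lemma lglW_mul_derivative (h : IsLGL N nd) (hN : 2 ≤ N) (hΨ : IsLagrange N nd Ψ)
    {a b : Fin (N + 1)} (hab : a = b → a ≠ 0 ∧ a ≠ Fin.last N) :
    lglW N Ψ b * (derivative (Ψ a)).eval (nd b) =
      -(lglW N Ψ a * (derivative (Ψ b)).eval (nd a)) := by
  have hdeg : (derivative (Ψ a * Ψ b)).natDegree + 1 ≤ 2 * N := by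
    have := natDegree_derivative_le (Ψ a * Ψ b)
    have := natDegree_mul_le (p := Ψ a) (q := Ψ b)
    have := (hΨ a).1
    have := (hΨ b).1
    omega
  have h1 := polyInt_eq_quadrature h hN hΨ hdeg
  have h2 : (Ψ a * Ψ b).eval 1 = 0 := by
    rw [← h.2.2.1, eval_mul, (hΨ a).2, (hΨ b).2]
    by_cases h3 : Fin.last N = a
    · rw [if_neg (show Fin.last N ≠ b from fun h4 => (hab (h3.symm.trans h4)).2 h3.symm), mul_zero]
    · rw [if_neg h3, zero_mul]
  have h3 : (Ψ a * Ψ b).eval (-1) = 0 := by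
    rw [← h.2.1, eval_mul, (hΨ a).2, (hΨ b).2]
    by_cases h3 : 0 = a
    · rw [if_neg (show 0 ≠ b from fun h4 => (hab (h3.symm.trans h4)).1 h3.symm), mul_zero]
    · rw [if_neg h3, zero_mul]
  rw [polyInt_derivative, h2, h3, sub_zero, derivative_mul] at h1
  simp only [eval_add, eval_mul, (hΨ _).2, mul_add, sum_add_distrib] at h1
  simp only [mul_ite, ite_mul, mul_one, mul_zero, one_mul, zero_mul, sum_ite_eq', mem_univ,
    if_true] at h1
  linarith

end LGL

section Tensor

variable {d N : ℕ}

/-- The tensor-product Lagrange interpolant with nodal values `c`. -/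
def lagInterp (Ψ : Fin (N + 1) → ℝ[X]) (c : (Fin d → Fin (N + 1)) → ℝ) (x : Vec d) : ℝ :=
  ∑ k, c k * ∏ j, (Ψ (k j)).eval (x j)

/-- Collocation differentiation in the `j`-th variable acting on nodal values. -/
def nodeDiff (nd : Fin (N + 1) → ℝ) (Ψ : Fin (N + 1) → ℝ[X]) (j : Fin d)
    (c : (Fin d → Fin (N + 1)) → ℝ) (k : Fin d → Fin (N + 1)) : ℝ :=
  ∑ m, (derivative (Ψ m)).eval (nd (k j)) * c (Function.update k j m)

lemma sum_sum_update_comm (j : Fin d) (F : (Fin d → Fin (N + 1)) → Fin (N + 1) → ℝ) :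
    ∑ k, ∑ m, F k m = ∑ k : Fin d → Fin (N + 1), ∑ m, F (Function.update k j m) (k j) := by
  rw [← Fintype.sum_prod_type', ← Fintype.sum_prod_type']
  let e : ((Fin d → Fin (N + 1)) × Fin (N + 1)) → ((Fin d → Fin (N + 1)) × Fin (N + 1)) :=
    fun p => (Function.update p.1 j p.2, p.1 j)
  have he : Function.Involutive e := fun p => by simp [e]
  exact (Equiv.sum_comp he.toPerm fun p => F p.1 p.2).symm

lemma continuous_lagInterp (Ψ : Fin (N + 1) → ℝ[X]) (c : (Fin d → Fin (N + 1)) → ℝ) :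
    Continuous (lagInterp Ψ c) :=
  continuous_finsetSum _ fun k _ => continuous_const.mul <|
    continuous_finsetProd _ fun j _ => (Ψ (k j)).continuous.comp (continuous_apply j)

lemma differentiable_lagInterp (Ψ : Fin (N + 1) → ℝ[X]) (c : (Fin d → Fin (N + 1)) → ℝ) :
    Differentiable ℝ (lagInterp Ψ c) := by
  unfold lagInterp
  refine Differentiable.fun_sum fun k _ => (differentiable_const _).mul ?_
  refine (contDiff_prod (n := 1) fun j _ => ?_).differentiable one_ne_zero
  have : ContDiff ℝ 1 fun t : ℝ => (Ψ (k j)).eval t := by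
    simpa using (Ψ (k j)).contDiff_aeval (𝕜 := ℝ) 1
  exact this.comp (contDiff_apply ℝ ℝ j)

lemma prod_eval_update (Ψ : Fin (N + 1) → ℝ[X]) (j : Fin d) (k : Fin d → Fin (N + 1))
    (m : Fin (N + 1)) (s : ℝ) (x : Vec d) :
    ∏ i, (Ψ (Function.update k j m i)).eval (Function.update x j s i) =
      (Ψ m).eval s * ∏ i ∈ univ.erase j, (Ψ (k i)).eval (x i) := by
  rw [← mul_prod_erase univ _ (mem_univ j)]
  simp only [Function.update_self]
  congr 1
  refine prod_congr rfl fun i hi => ?_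
  rw [Function.update_of_ne (ne_of_mem_erase hi), Function.update_of_ne (ne_of_mem_erase hi)]

lemma pd_eq_of_hasDerivAt {f : Vec d → ℝ} {x : Vec d} {j : Fin d} {f' : ℝ}
    (hf : DifferentiableAt ℝ f x)
    (h : HasDerivAt (fun s => f (Function.update x j s)) f' (x j)) : pd j f x = f' := by
  have h1 : HasFDerivAt f (fderiv ℝ f x) (Function.update x j (x j)) := by
    rw [Function.update_eq_self]
    exact hf.hasFDerivAt
  exact (h1.comp_hasDerivAt (x j) (hasDerivAt_update x j (x j))).unique h

lemma pd_lagInterp {nd : Fin (N + 1) → ℝ} {Ψ : Fin (N + 1) → ℝ[X]} (h : IsLGL N nd)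
    (hΨ : IsLagrange N nd Ψ) (j : Fin d) (c : (Fin d → Fin (N + 1)) → ℝ) :
    pd j (lagInterp Ψ c) = lagInterp Ψ (nodeDiff nd Ψ j c) := by
  funext x
  have h1 : ∀ s, lagInterp Ψ c (Function.update x j s) =
      ∑ k, c k * ((Ψ (k j)).eval s * ∏ i ∈ univ.erase j, (Ψ (k i)).eval (x i)) := fun s =>
    sum_congr rfl fun k _ => by
      rw [← prod_eval_update Ψ j k (k j) s x, Function.update_eq_self]
  have h2 : HasDerivAt (fun s => lagInterp Ψ c (Function.update x j s))
      (∑ k, c k * ((derivative (Ψ (k j))).eval (x j) *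
        ∏ i ∈ univ.erase j, (Ψ (k i)).eval (x i))) (x j) := by
    simp only [h1]
    exact HasDerivAt.fun_sum fun k _ => (((Ψ (k j)).hasDerivAt (x j)).mul_const _).const_mul _
  rw [pd_eq_of_hasDerivAt (differentiable_lagInterp Ψ c x) h2]
  have hdeg : ∀ m, (derivative (Ψ m)).natDegree ≤ N := fun m =>
    ((natDegree_derivative_le _).trans (Nat.sub_le _ _)).trans (hΨ m).1
  simp only [lagInterp, nodeDiff, sum_mul]
  rw [sum_sum_update_comm j]
  refine sum_congr rfl fun k _ => ?_
  rw [eval_eq_sum_lagrange h hΨ (hdeg _), sum_mul, mul_sum]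
  refine sum_congr rfl fun m _ => ?_
  have h3 := prod_eval_update Ψ j k m (x j) x
  rw [Function.update_eq_self] at h3
  rw [h3, Function.update_self, Function.update_idem, Function.update_eq_self]
  ring

lemma lagInterp_add (Ψ : Fin (N + 1) → ℝ[X]) (c e : (Fin d → Fin (N + 1)) → ℝ) (x : Vec d) :
    lagInterp Ψ (fun k => c k + e k) x = lagInterp Ψ c x + lagInterp Ψ e x := by
  simp only [lagInterp, add_mul, sum_add_distrib]

lemma lagInterp_const_mul (Ψ : Fin (N + 1) → ℝ[X]) (a : ℝ) (c : (Fin d → Fin (N + 1)) → ℝ)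
    (x : Vec d) : lagInterp Ψ (fun k => a * c k) x = a * lagInterp Ψ c x := by
  simp only [lagInterp, mul_sum, mul_assoc]

lemma lagInterp_sum {ι : Type*} (s : Finset ι) (Ψ : Fin (N + 1) → ℝ[X])
    (c : ι → (Fin d → Fin (N + 1)) → ℝ) (x : Vec d) :
    lagInterp Ψ (fun k => ∑ i ∈ s, c i k) x = ∑ i ∈ s, lagInterp Ψ (c i) x := by
  simp only [lagInterp, sum_mul]
  exact sum_comm

section Nodes

variable {nd : Fin (N + 1) → ℝ} {Ψ : Fin (N + 1) → ℝ[X]}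

lemma lagInterp_nodeP (hΨ : IsLagrange N nd Ψ) (c : (Fin d → Fin (N + 1)) → ℝ)
    (k : Fin d → Fin (N + 1)) : lagInterp Ψ c (nodeP nd k) = c k := by
  have : ∀ l : Fin d → Fin (N + 1), ∏ j, (Ψ (l j)).eval (nodeP nd k j) =
      if l = k then 1 else 0 := by
    intro l
    simp only [nodeP, (hΨ _).2]
    rw [Fintype.prod_ite_zero]
    simp [funext_iff, eq_comm]
  simp [lagInterp, this]

lemma lagInterp_monomial (h : IsLGL N nd) (hΨ : IsLagrange N nd Ψ) (a : Fin d → ℕ)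
    (ha : ∀ j, a j ≤ N) (x : Vec d) :
    ∏ j, x j ^ a j = lagInterp Ψ (fun k => ∏ j, nodeP nd k j ^ a j) x := by
  have : ∀ j, x j ^ a j = ∑ m, nd m ^ a j * (Ψ m).eval (x j) := fun j => by
    have := eval_eq_sum_lagrange h hΨ (p := X ^ a j) ((natDegree_X_pow_le _).trans (ha j)) (x j)
    simpa using this
  simp only [this, lagInterp, nodeP]
  rw [prod_univ_sum, Fintype.piFinset_univ]
  simp only [prod_mul_distrib]

lemma MemPolyN.eq_lagInterp {p : Vec d → ℝ} (hp : MemPolyN d N p) (h : IsLGL N nd)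
    (hΨ : IsLagrange N nd Ψ) : p = lagInterp Ψ fun k => p (nodeP nd k) := by
  obtain ⟨q, hq, hqp⟩ := hp
  funext x
  simp only [← hqp, MvPolynomial.eval_eq']
  rw [lagInterp_sum]
  refine sum_congr rfl fun a ha => ?_
  rw [lagInterp_const_mul, ← lagInterp_monomial h hΨ]
  intro j
  exact (MvPolynomial.monomial_le_degreeOf j ha).trans (hq j)

lemma sum_nodeDiff_mul (h : IsLGL N nd) (hN : 2 ≤ N) (hΨ : IsLagrange N nd Ψ) (j : Fin d)
    (c e : (Fin d → Fin (N + 1)) → ℝ)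
    (he : ∀ k : Fin d → Fin (N + 1), k j = 0 ∨ k j = Fin.last N → e k = 0) :
    ∑ k, (∏ i, lglW N Ψ (k i)) * (nodeDiff nd Ψ j c k * e k) =
      -∑ k, (∏ i, lglW N Ψ (k i)) * (c k * nodeDiff nd Ψ j e k) := by
  simp only [nodeDiff, sum_mul, mul_sum]
  rw [sum_sum_update_comm j, ← sum_neg_distrib]
  refine sum_congr rfl fun k _ => ?_
  rw [← sum_neg_distrib]
  refine sum_congr rfl fun m _ => ?_
  rw [Function.update_self, Function.update_idem, Function.update_eq_self,
    ← mul_prod_erase univ _ (mem_univ j), ← mul_prod_erase univ (fun i => lglW N Ψ (k i))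
    (mem_univ j), Function.update_self,
    prod_congr rfl fun i hi => by rw [Function.update_of_ne (ne_of_mem_erase hi)]]
  by_cases hm : k j = m → k j ≠ 0 ∧ k j ≠ Fin.last N
  · linear_combination (∏ i ∈ univ.erase j, lglW N Ψ (k i)) * c k * e (Function.update k j m) *
      lglW_mul_derivative h hN hΨ hm
  · have h0 : e (Function.update k j m) = 0 := by
      apply he
      rw [Function.update_self]
      push Not at hm
      obtain ⟨rfl, hm⟩ := hm
      by_cases h1 : k j = 0
      · exact Or.inl h1
      · exact Or.inr (hm h1)
    rw [h0]
    ring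

end Nodes

lemma isCompact_cubeC (d : ℕ) : IsCompact (cubeC d) :=
  isCompact_univ_pi fun _ => isCompact_Icc

lemma restrict_cubeC (d : ℕ) :
    (volume : Measure (Vec d)).restrict (cubeC d) = Measure.pi fun _ : Fin d =>
      (volume : Measure ℝ).restrict (Set.Ioc (-1) 1) := by
  rw [cubeC, volume_pi, Measure.restrict_pi_pi]
  congr 1
  funext _
  exact Measure.restrict_congr_set Ioc_ae_eq_Icc.symm

lemma restrict_cubeO (d : ℕ) :
    (volume : Measure (Vec d)).restrict (cubeO d) =
      (volume : Measure (Vec d)).restrict (cubeC d) := by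
  rw [restrict_cubeC, cubeO, volume_pi, Measure.restrict_pi_pi]
  congr 1
  funext _
  exact Measure.restrict_congr_set Ioo_ae_eq_Ioc

lemma Continuous.integrableOn_cubeC {f : Vec d → ℝ} (hf : Continuous f) :
    IntegrableOn f (cubeC d) :=
  hf.continuousOn.integrableOn_compact (isCompact_cubeC d)

/-- The square of a tensor-product expansion integrates to its Gram form. -/
lemma integral_sq_tensor (f : Fin d → Fin (N + 1) → ℝ[X]) (c : (Fin d → Fin (N + 1)) → ℝ) :
    ∫ x in cubeC d, (∑ k, c k * ∏ j, (f j (k j)).eval (x j)) ^ 2 =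
      ∑ k, ∑ l, c k * c l * ∏ j, polyInt (f j (k j) * f j (l j)) := by
  have h1 : ∀ x : Vec d, (∑ k, c k * ∏ j, (f j (k j)).eval (x j)) ^ 2 =
      ∑ k, ∑ l, c k * c l * ∏ j, (f j (k j) * f j (l j)).eval (x j) := fun x => by
    rw [sq, sum_mul_sum]
    refine sum_congr rfl fun k _ => sum_congr rfl fun l _ => ?_
    simp only [eval_mul, prod_mul_distrib]
    ring
  have hcont : ∀ k l : Fin d → Fin (N + 1), Continuous fun x : Vec d =>
      c k * c l * ∏ j, (f j (k j) * f j (l j)).eval (x j) := fun k l =>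
    continuous_const.mul <| continuous_finsetProd _ fun j _ =>
      (f j (k j) * f j (l j)).continuous.comp (continuous_apply j)
  simp only [h1]
  rw [integral_finsetSum _ fun k _ =>
    (continuous_finsetSum _ fun l _ => hcont k l).integrableOn_cubeC]
  refine sum_congr rfl fun k _ => ?_
  rw [integral_finsetSum _ fun l _ => (hcont k l).integrableOn_cubeC]
  refine sum_congr rfl fun l _ => ?_
  rw [integral_const_mul, restrict_cubeC,
    integral_fintype_prod_eq_prod fun j t => (f j (k j) * f j (l j)).eval t]
  congr 1
  refine prod_congr rfl fun j _ => ?_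
  rw [polyInt_apply, intervalIntegral.integral_of_le (by norm_num)]

lemma exists_polyInt_splitting {nd : Fin (N + 1) → ℝ} {Ψ : Fin (N + 1) → ℝ[X]}
    (h : IsLGL N nd) (hN : 2 ≤ N) (hΨ : IsLagrange N nd Ψ) :
    ∃ g : Bool → Fin (N + 1) → ℝ[X], g true = Ψ ∧
      ∀ a b, ∑ s : Bool, polyInt (g s a * g s b) = if a = b then lglW N Ψ a else 0 := by
  obtain ⟨κ, hκ, H⟩ := exists_quadrature_defect h hN hΨ
  refine ⟨fun b m => if b then Ψ m else C (Real.sqrt (κ / 2) * (Ψ m).coeff N), by simp, ?_⟩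
  intro a b
  have h2 : polyInt (C (Real.sqrt (κ / 2) * (Ψ a).coeff N) *
      C (Real.sqrt (κ / 2) * (Ψ b).coeff N)) = κ * ((Ψ a).coeff N * (Ψ b).coeff N) := by
    have := Real.mul_self_sqrt (show 0 ≤ κ / 2 by positivity)
    rw [polyInt_apply]
    simp only [eval_mul, eval_C, intervalIntegral.integral_const, smul_eq_mul]
    linear_combination 2 * ((Ψ a).coeff N * (Ψ b).coeff N) * this
  rw [H a b, Fintype.sum_bool]
  simp only [if_true, Bool.false_eq_true, if_false, h2]

/-- The continuous `L²` norm is dominated by the discrete one. -/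
lemma integral_lagInterp_sq_le {nd : Fin (N + 1) → ℝ} {Ψ : Fin (N + 1) → ℝ[X]}
    (h : IsLGL N nd) (hN : 2 ≤ N) (hΨ : IsLagrange N nd Ψ) (c : (Fin d → Fin (N + 1)) → ℝ) :
    ∫ x in cubeC d, lagInterp Ψ c x ^ 2 ≤ ∑ k, (∏ j, lglW N Ψ (k j)) * (c k * c k) := by
  obtain ⟨g, rfl, hg⟩ := exists_polyInt_splitting h hN hΨ
  have h3 : ∀ k l : Fin d → Fin (N + 1), ∑ s : Fin d → Bool,
      ∏ j, polyInt (g (s j) (k j) * g (s j) (l j)) =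
        if k = l then ∏ j, lglW N (g true) (k j) else 0 := fun k l => by
    have := prod_univ_sum (fun _ => univ) fun (j : Fin d) b => polyInt (g b (k j) * g b (l j))
    rw [Fintype.piFinset_univ] at this
    rw [← this]
    simp only [hg]
    rw [Fintype.prod_ite_zero]
    by_cases hkl : k = l
    · simp [hkl]
    · rw [if_neg hkl, if_neg (mt funext hkl)]
  have h1 : ∑ k, (∏ j, lglW N (g true) (k j)) * (c k * c k) =
      ∑ s : Fin d → Bool, ∫ x in cubeC d,
        (∑ k, c k * ∏ j, (g (s j) (k j)).eval (x j)) ^ 2 := by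
    simp only [fun s : Fin d → Bool => integral_sq_tensor (fun j => g (s j)) c]
    rw [sum_comm]
    refine sum_congr rfl fun k _ => ?_
    rw [sum_comm]
    simp only [← mul_sum, h3, mul_ite, mul_zero, sum_ite_eq, mem_univ, if_true]
    ring
  rw [h1]
  exact single_le_sum (f := fun s : Fin d → Bool => ∫ x in cubeC d,
      (∑ k, c k * ∏ j, (g (s j) (k j)).eval (x j)) ^ 2)
    (fun s _ => integral_nonneg fun x => sq_nonneg _) (mem_univ fun _ => true)

/-- Nodal values restricted to the face `x_j = 1`, extended by zero. -/
def faceTrace (j : Fin d) (c : (Fin d → Fin (N + 1)) → ℝ) (k : Fin d → Fin (N + 1)) : ℝ :=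
  if k j = Fin.last N then c k else 0

lemma lagInterp_update_one {nd : Fin (N + 1) → ℝ} {Ψ : Fin (N + 1) → ℝ[X]}
    (h : IsLGL N nd) (hΨ : IsLagrange N nd Ψ) (j : Fin d) (c : (Fin d → Fin (N + 1)) → ℝ)
    (x : Vec d) : lagInterp Ψ c (Function.update x j 1) =
      ∑ k, faceTrace j c k * ∏ i, ((if i = j then fun _ => 1 else Ψ : _ → ℝ[X]) (k i)).eval
        (x i) := by
  refine sum_congr rfl fun k _ => ?_
  have h1 := prod_eval_update Ψ j k (k j) 1 x
  rw [Function.update_eq_self] at h1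
  have h2 : ∏ i ∈ univ.erase j, ((if i = j then fun _ => 1 else Ψ : _ → ℝ[X]) (k i)).eval (x i) =
      ∏ i ∈ univ.erase j, (Ψ (k i)).eval (x i) :=
    prod_congr rfl fun i hi => by rw [if_neg (ne_of_mem_erase hi)]
  rw [h1, ← mul_prod_erase univ _ (mem_univ j), if_pos rfl, eval_one, one_mul, h2, ← h.2.2.1,
    (hΨ _).2, faceTrace]
  simp only [eq_comm (a := Fin.last N)]
  split_ifs <;> simp

lemma sum_filter_face {nd : Fin (N + 1) → ℝ} {Ψ : Fin (N + 1) → ℝ[X]}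
    (h : IsLGL N nd) (j : Fin d) (c : (Fin d → Fin (N + 1)) → ℝ) (x : Vec d) :
    ∑ k ∈ univ.filter (fun k : Fin d → Fin (N + 1) => nodeP nd k j = 1),
        c k * ∏ i, (Ψ (k i)).eval (x i) =
      ∑ k, faceTrace j c k * ∏ i,
        ((if i = j then fun _ => Ψ (Fin.last N) else Ψ : _ → ℝ[X]) (k i)).eval (x i) := by
  rw [sum_filter]
  refine sum_congr rfl fun k _ => ?_
  have h1 : nodeP nd k j = 1 ↔ k j = Fin.last N := by
    rw [nodeP, ← h.2.2.1, h.1.injective.eq_iff]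
  rw [faceTrace]
  by_cases hk : k j = Fin.last N
  · rw [if_pos (h1.2 hk), if_pos hk]
    congr 1
    refine prod_congr rfl fun i _ => ?_
    by_cases hi : i = j
    · subst hi
      rw [if_pos rfl, hk]
    · rw [if_neg hi]
  · rw [if_neg (mt h1.1 hk), if_neg hk, zero_mul]

lemma integral_lagInterp_update_sq {nd : Fin (N + 1) → ℝ} {Ψ : Fin (N + 1) → ℝ[X]}
    (h : IsLGL N nd) (hΨ : IsLagrange N nd Ψ) (j : Fin d) (c : (Fin d → Fin (N + 1)) → ℝ) :
    ∫ x in cubeC d, lagInterp Ψ c (Function.update x j 1) ^ 2 =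
      ∑ k, ∑ l, faceTrace j c k * faceTrace j c l *
        (2 * ∏ i ∈ univ.erase j, polyInt (Ψ (k i) * Ψ (l i))) := by
  simp only [lagInterp_update_one h hΨ j c]
  rw [integral_sq_tensor fun i => if i = j then fun _ => 1 else Ψ]
  refine sum_congr rfl fun k _ => sum_congr rfl fun l _ => ?_
  rw [← mul_prod_erase univ _ (mem_univ j), if_pos rfl,
    prod_congr rfl fun i hi => by rw [if_neg (ne_of_mem_erase hi)]]
  congr 2
  rw [polyInt_apply]
  norm_num

lemma integral_face_sq {nd : Fin (N + 1) → ℝ} {Ψ : Fin (N + 1) → ℝ[X]}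
    (h : IsLGL N nd) (hΨ : IsLagrange N nd Ψ) (j : Fin d) (c : (Fin d → Fin (N + 1)) → ℝ) :
    ∫ x in cubeC d, (∑ k ∈ univ.filter (fun k : Fin d → Fin (N + 1) => nodeP nd k j = 1),
        c k * ∏ i, (Ψ (k i)).eval (x i)) ^ 2 =
      polyInt (Ψ (Fin.last N) * Ψ (Fin.last N)) *
        ((1 / 2) * ∫ x in cubeC d, lagInterp Ψ c (Function.update x j 1) ^ 2) := by
  rw [integral_lagInterp_update_sq h hΨ]
  simp only [sum_filter_face h j c]
  rw [integral_sq_tensor fun i => if i = j then fun _ => Ψ (Fin.last N) else Ψ, mul_sum, mul_sum]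
  refine sum_congr rfl fun k _ => ?_
  rw [mul_sum, mul_sum]
  refine sum_congr rfl fun l _ => ?_
  rw [← mul_prod_erase univ _ (mem_univ j), if_pos rfl,
    prod_congr rfl fun i hi => by rw [if_neg (ne_of_mem_erase hi)]]
  ring

/-- The discrete inner product of nodal values. -/
def nodeInner (Ψ : Fin (N + 1) → ℝ[X]) (a b : (Fin d → Fin (N + 1)) → ℝ) : ℝ :=
  ∑ k, (∏ j, lglW N Ψ (k j)) * (a k * b k)

/-- Collocation divergence acting on nodal values. -/
def nodeDiv (nd : Fin (N + 1) → ℝ) (Ψ : Fin (N + 1) → ℝ[X])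
    (v : Fin d → (Fin d → Fin (N + 1)) → ℝ) (k : Fin d → Fin (N + 1)) : ℝ :=
  ∑ j, nodeDiff nd Ψ j (v j) k

/-- Nodal values of `μ ∂²v/∂ν² + (λ+μ) ν ∂(div v)/∂ν` for `ν = e_j`. -/
def nodeObs (lam mu : ℝ) (nd : Fin (N + 1) → ℝ) (Ψ : Fin (N + 1) → ℝ[X]) (j : Fin d)
    (v : Fin d → (Fin d → Fin (N + 1)) → ℝ) (i : Fin d) (k : Fin d → Fin (N + 1)) : ℝ :=
  mu * nodeDiff nd Ψ j (nodeDiff nd Ψ j (v i)) k +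
    ((lam + mu) * if i = j then 1 else 0) * nodeDiff nd Ψ j (nodeDiv nd Ψ v) k

/-- Collocation elasticity operator acting on nodal values. -/
def nodeElast (lam mu : ℝ) (nd : Fin (N + 1) → ℝ) (Ψ : Fin (N + 1) → ℝ[X])
    (v : Fin d → (Fin d → Fin (N + 1)) → ℝ) (i : Fin d) (k : Fin d → Fin (N + 1)) : ℝ :=
  mu * ∑ j, nodeDiff nd Ψ j (nodeDiff nd Ψ j (v i)) k +
    (lam + mu) * nodeDiff nd Ψ i (nodeDiv nd Ψ v) k

/-- Discrete energy of nodal velocities `w` and nodal displacements `v`. -/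
def nodeEnergy (lam mu : ℝ) (nd : Fin (N + 1) → ℝ) (Ψ : Fin (N + 1) → ℝ[X])
    (w v : Fin d → (Fin d → Fin (N + 1)) → ℝ) : ℝ :=
  (1 / 2) * ((∑ i, nodeInner Ψ (w i) (w i)) +
    mu * ∑ i, ∑ j, nodeInner Ψ (nodeDiff nd Ψ j (v i)) (nodeDiff nd Ψ j (v i)) +
    (lam + mu) * nodeInner Ψ (nodeDiv nd Ψ v) (nodeDiv nd Ψ v))

section Field

variable {nd : Fin (N + 1) → ℝ} {Ψ : Fin (N + 1) → ℝ[X]} {u : Vec d → Fin d → ℝ}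
  {v : Fin d → (Fin d → Fin (N + 1)) → ℝ}

lemma vdiv_eq_lagInterp (h : IsLGL N nd) (hΨ : IsLagrange N nd Ψ)
    (hu : ∀ i, (fun x => u x i) = lagInterp Ψ (v i)) :
    vdiv u = lagInterp Ψ (nodeDiv nd Ψ v) := by
  funext x
  simp only [vdiv, hu, pd_lagInterp h hΨ]
  rw [← lagInterp_sum]
  rfl

lemma obs2_eq_lagInterp (h : IsLGL N nd) (hΨ : IsLagrange N nd Ψ)
    (hu : ∀ i, (fun x => u x i) = lagInterp Ψ (v i)) (lam mu : ℝ) (j : Fin d) (x : Vec d)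
    (i : Fin d) :
    obs2 lam mu u j 1 x i = lagInterp Ψ (nodeObs lam mu nd Ψ j v i) x := by
  unfold obs2 nodeObs
  rw [lagInterp_add, lagInterp_const_mul, lagInterp_const_mul, hu, vdiv_eq_lagInterp h hΨ hu,
    pd_lagInterp h hΨ, pd_lagInterp h hΨ, pd_lagInterp h hΨ]
  simp only [one_mul]

lemma elast_eq_nodeElast (h : IsLGL N nd) (hΨ : IsLagrange N nd Ψ)
    (hu : ∀ i, (fun x => u x i) = lagInterp Ψ (v i)) (lam mu : ℝ) (k : Fin d → Fin (N + 1))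
    (i : Fin d) : elast lam mu u (nodeP nd k) i = nodeElast lam mu nd Ψ v i k := by
  simp only [elast, nodeElast, hu, vdiv_eq_lagInterp h hΨ hu, pd_lagInterp h hΨ,
    lagInterp_nodeP hΨ]

lemma nodeInner_self_nonneg (h : IsLGL N nd) (hN : 2 ≤ N) (hΨ : IsLagrange N nd Ψ)
    (a : (Fin d → Fin (N + 1)) → ℝ) : 0 ≤ nodeInner Ψ a a :=
  sum_nonneg fun _ _ => mul_nonneg (prod_nonneg fun _ _ => lglW_nonneg h hN hΨ _)
    (mul_self_nonneg _)

lemma nodeInner_comm (a b : (Fin d → Fin (N + 1)) → ℝ) :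
    nodeInner Ψ a b = nodeInner Ψ b a := by
  simp only [nodeInner, mul_comm (a _)]

lemma nodeInner_sum_right {ι : Type*} (s : Finset ι) (a : (Fin d → Fin (N + 1)) → ℝ)
    (b : ι → (Fin d → Fin (N + 1)) → ℝ) :
    nodeInner Ψ a (fun k => ∑ i ∈ s, b i k) = ∑ i ∈ s, nodeInner Ψ a (b i) := by
  simp only [nodeInner, mul_sum]
  exact sum_comm

lemma sum_nodeInner_nodeElast (h : IsLGL N nd) (hN : 2 ≤ N) (hΨ : IsLagrange N nd Ψ)
    (lam mu : ℝ) (v w : Fin d → (Fin d → Fin (N + 1)) → ℝ)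
    (hw : ∀ i k, (∃ j, k j = 0 ∨ k j = Fin.last N) → w i k = 0) :
    ∑ i, nodeInner Ψ (nodeElast lam mu nd Ψ v i) (w i) =
      -(mu * ∑ i, ∑ j, nodeInner Ψ (nodeDiff nd Ψ j (v i)) (nodeDiff nd Ψ j (w i)) +
        (lam + mu) * nodeInner Ψ (nodeDiv nd Ψ v) (nodeDiv nd Ψ w)) := by
  have h1 : ∀ i j c, nodeInner Ψ (nodeDiff nd Ψ j c) (w i) =
      -nodeInner Ψ c (nodeDiff nd Ψ j (w i)) := fun i j c =>
    sum_nodeDiff_mul h hN hΨ j c (w i) fun k hk => hw i k ⟨j, hk⟩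
  have h2 : ∀ i, nodeInner Ψ (nodeElast lam mu nd Ψ v i) (w i) =
      mu * ∑ j, nodeInner Ψ (nodeDiff nd Ψ j (nodeDiff nd Ψ j (v i))) (w i) +
        (lam + mu) * nodeInner Ψ (nodeDiff nd Ψ i (nodeDiv nd Ψ v)) (w i) := by
    intro i
    simp only [nodeInner_comm _ (w i)]
    rw [← nodeInner_sum_right]
    simp only [nodeInner, nodeElast, mul_sum, ← sum_add_distrib]
    refine sum_congr rfl fun k _ => ?_
    simp only [mul_add, mul_sum]
    congr 1
    · refine sum_congr rfl fun j _ => ?_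
      ring
    · ring
  simp only [h2, h1]
  rw [sum_add_distrib, ← mul_sum, ← mul_sum]
  have h3 : nodeInner Ψ (nodeDiv nd Ψ v) (nodeDiv nd Ψ w) =
      ∑ i, nodeInner Ψ (nodeDiv nd Ψ v) (nodeDiff nd Ψ i (w i)) :=
    nodeInner_sum_right univ _ _
  simp only [sum_neg_distrib]
  rw [h3]
  ring

lemma abs_setIntegral_multiplier_le (h : IsLGL N nd) (hN : 2 ≤ N) (hΨ : IsLagrange N nd Ψ)
    (v : Fin d → (Fin d → Fin (N + 1)) → ℝ) {F : Fin d → Vec d → ℝ} (hF : ∀ i, Continuous (F i))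
    {ε : ℝ} (hε : 0 < ε) :
    |∫ x in cubeO d, ∑ i, F i x * ∑ j, (x j + 1) * lagInterp Ψ (nodeDiff nd Ψ j (v i)) x| ≤
      1 / (4 * ε) * (∑ i, ∫ x in cubeC d, F i x ^ 2) +
        ε * (4 * d * ∑ i, ∑ j, nodeInner Ψ (nodeDiff nd Ψ j (v i)) (nodeDiff nd Ψ j (v i))) := by
  have hD : ∀ i j, Continuous (lagInterp Ψ (nodeDiff nd Ψ j (v i))) := fun i j =>
    continuous_lagInterp _ _
  have hpt : ∀ x ∈ cubeC d,
      |∑ i, F i x * ∑ j, (x j + 1) * lagInterp Ψ (nodeDiff nd Ψ j (v i)) x| ≤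
        ∑ i, (1 / (4 * ε) * F i x ^ 2 +
          ε * (4 * d * ∑ j, lagInterp Ψ (nodeDiff nd Ψ j (v i)) x ^ 2)) := by
    intro x hx
    refine (abs_sum_le_sum_abs _ _).trans (sum_le_sum fun i _ => ?_)
    set H := ∑ j, (x j + 1) * lagInterp Ψ (nodeDiff nd Ψ j (v i)) x with hH
    have h1 : H ^ 2 ≤ 4 * d * ∑ j, lagInterp Ψ (nodeDiff nd Ψ j (v i)) x ^ 2 := by
      have h2 := sq_sum_le_card_mul_sum_sq (s := univ)
        (f := fun j => (x j + 1) * lagInterp Ψ (nodeDiff nd Ψ j (v i)) x)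
      rw [card_univ, Fintype.card_fin] at h2
      refine h2.trans ?_
      rw [mul_comm (4 : ℝ), mul_assoc, mul_sum _ _ (4 : ℝ)]
      refine mul_le_mul_of_nonneg_left (sum_le_sum fun j _ => ?_) d.cast_nonneg
      have hxj := hx j (Set.mem_univ j)
      rw [mul_pow]
      refine mul_le_mul_of_nonneg_right ?_ (sq_nonneg _)
      nlinarith [hxj.1, hxj.2]
    have h3 : |F i x * H| ≤ 1 / (4 * ε) * F i x ^ 2 + ε * H ^ 2 := by
      have h4 : ∀ s : ℝ, s ^ 2 = 1 →
          1 / (4 * ε) * F i x ^ 2 + ε * H ^ 2 - s * (F i x * H) =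
            ε * (s * F i x / (2 * ε) - H) ^ 2 := fun s hs => by
        have : ε * (s * F i x / (2 * ε) - H) ^ 2 =
            s ^ 2 * (1 / (4 * ε) * F i x ^ 2) + ε * H ^ 2 - s * (F i x * H) := by
          field_simp
          ring
        rw [this, hs, one_mul]
      have h5 := h4 1 (by norm_num)
      have h6 := h4 (-1) (by norm_num)
      have h7 : 0 ≤ ε * (1 * F i x / (2 * ε) - H) ^ 2 := by positivity
      have h8 : 0 ≤ ε * (-1 * F i x / (2 * ε) - H) ^ 2 := by positivity
      rw [abs_le]
      constructor <;> linarith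
    exact h3.trans (by gcongr)
  rw [restrict_cubeO]
  refine (abs_integral_le_integral_abs).trans ?_
  have hcF : ∀ i, Continuous fun x => 1 / (4 * ε) * F i x ^ 2 := fun i =>
    continuous_const.mul ((hF i).pow 2)
  have hsq : ∀ i j, Continuous fun x : Vec d => lagInterp Ψ (nodeDiff nd Ψ j (v i)) x ^ 2 :=
    fun i j => (hD i j).pow 2
  have hcS : ∀ i, Continuous fun x : Vec d =>
      ∑ j, lagInterp Ψ (nodeDiff nd Ψ j (v i)) x ^ 2 := fun i =>
    continuous_finsetSum _ fun j _ => hsq i j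
  have hcD : ∀ i, Continuous fun x : Vec d =>
      ε * (4 * d * ∑ j, lagInterp Ψ (nodeDiff nd Ψ j (v i)) x ^ 2) := fun i =>
    continuous_const.mul (continuous_const.mul (hcS i))
  have hcL : Continuous fun x : Vec d =>
      |∑ i, F i x * ∑ j, (x j + 1) * lagInterp Ψ (nodeDiff nd Ψ j (v i)) x| := by
    refine (continuous_finsetSum _ fun i _ => (hF i).mul <| continuous_finsetSum _ fun j _ => ?_).abs
    exact ((continuous_apply j).add continuous_const).mul (hD i j)
  refine (setIntegral_mono_on hcL.integrableOn_cubeC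
    (continuous_finsetSum _ fun i _ => (hcF i).add (hcD i)).integrableOn_cubeC
    (isCompact_cubeC d).measurableSet hpt).trans ?_
  rw [integral_finsetSum _ fun i _ => ((hcF i).add (hcD i)).integrableOn_cubeC, mul_sum, mul_sum,
    mul_sum, ← sum_add_distrib]
  refine sum_le_sum fun i _ => ?_
  rw [integral_add' (hcF i).integrableOn_cubeC (hcD i).integrableOn_cubeC, integral_const_mul,
    integral_const_mul, integral_const_mul,
    integral_finsetSum _ fun j _ => (hsq i j).integrableOn_cubeC]
  gcongr with j
  exact integral_lagInterp_sq_le h hN hΨ _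

lemma mul_sum_nodeInner_le_nodeEnergy (h : IsLGL N nd) (hN : 2 ≤ N) (hΨ : IsLagrange N nd Ψ)
    {lam mu : ℝ} (hlam : 0 < lam) (hmu : 0 < mu) (w v : Fin d → (Fin d → Fin (N + 1)) → ℝ) :
    mu * ∑ i, ∑ j, nodeInner Ψ (nodeDiff nd Ψ j (v i)) (nodeDiff nd Ψ j (v i)) ≤
      2 * nodeEnergy lam mu nd Ψ w v := by
  have h1 : 0 ≤ ∑ i, nodeInner Ψ (w i) (w i) :=
    sum_nonneg fun i _ => nodeInner_self_nonneg h hN hΨ _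
  have h2 : 0 ≤ (lam + mu) * nodeInner Ψ (nodeDiv nd Ψ v) (nodeDiv nd Ψ v) :=
    mul_nonneg (by positivity) (nodeInner_self_nonneg h hN hΨ _)
  unfold nodeEnergy
  linarith

/-- Multiplier estimate at a fixed time. -/
lemma abs_setIntegral_face_multiplier_le (h : IsLGL N nd) (hN : 2 ≤ N)
    (hΨ : IsLagrange N nd Ψ) (hu : ∀ i, (fun x => u x i) = lagInterp Ψ (v i)) {lam mu : ℝ}
    (hlam : 0 < lam) (hmu : 0 < mu) (w : Fin d → (Fin d → Fin (N + 1)) → ℝ) (j₀ : Fin d)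
    {ε : ℝ} (hε : 0 < ε) :
    |∫ x in cubeO d, ∑ i,
        (∑ k ∈ univ.filter (fun k : Fin d → Fin (N + 1) => nodeP nd k j₀ = 1),
          obs2 lam mu u j₀ 1 (nodeP nd k) i * ∏ j, (Ψ (k j)).eval (x j)) *
        ∑ j, (x j + 1) * pd j (fun y => u y i) x| ≤
      1 / (4 * ε) * (2 / ((N : ℝ) * ((N : ℝ) + 1))) *
        (faceInt d j₀ 1 fun x => ∑ i, (obs2 lam mu u j₀ 1 x i) ^ 2) +
      8 * (d : ℝ) / mu * ε * nodeEnergy lam mu nd Ψ w v := by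
  simp only [obs2_eq_lagInterp h hΨ hu, lagInterp_nodeP hΨ, hu, pd_lagInterp h hΨ]
  refine (abs_setIntegral_multiplier_le h hN hΨ v (fun i => ?_) hε).trans (add_le_add ?_ ?_)
  · exact continuous_finsetSum _ fun k _ => continuous_const.mul <|
      continuous_finsetProd _ fun j _ => (Ψ (k j)).continuous.comp (continuous_apply j)
  · rw [mul_assoc (1 / (4 * ε))]
    refine mul_le_mul_of_nonneg_left ?_ (by positivity)
    rw [faceInt, integral_finsetSum _ fun i _ => ?_, mul_sum, mul_sum]
    · refine sum_le_sum fun i _ => ?_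
      rw [integral_face_sq h hΨ]
      refine mul_le_mul_of_nonneg_right (polyInt_last_mul_last_le h hN hΨ) ?_
      exact mul_nonneg (by norm_num) (integral_nonneg fun x => sq_nonneg _)
    · refine Continuous.integrableOn_cubeC (((continuous_lagInterp Ψ _).comp ?_).pow 2)
      exact continuous_id.update j₀ continuous_const
  · have h1 := mul_sum_nodeInner_le_nodeEnergy h hN hΨ hlam hmu w v
    calc _ = 4 * d * ε / mu * (mu * ∑ i, ∑ j,
          nodeInner Ψ (nodeDiff nd Ψ j (v i)) (nodeDiff nd Ψ j (v i))) := by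
          field_simp
      _ ≤ 4 * d * ε / mu * (2 * nodeEnergy lam mu nd Ψ w v) := by gcongr
      _ = _ := by ring

end Field

section Evolution

variable {nd : Fin (N + 1) → ℝ} {Ψ : Fin (N + 1) → ℝ[X]} {t : ℝ}

lemma hasDerivAt_nodeDiff {c : ℝ → (Fin d → Fin (N + 1)) → ℝ} {c' : (Fin d → Fin (N + 1)) → ℝ}
    (hc : ∀ k, HasDerivAt (fun s => c s k) (c' k) t) (j : Fin d) (k : Fin d → Fin (N + 1)) :
    HasDerivAt (fun s => nodeDiff nd Ψ j (c s) k) (nodeDiff nd Ψ j c' k) t :=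
  HasDerivAt.fun_sum fun m _ => (hc (Function.update k j m)).const_mul _

lemma hasDerivAt_nodeDiv {v : ℝ → Fin d → (Fin d → Fin (N + 1)) → ℝ}
    {v' : Fin d → (Fin d → Fin (N + 1)) → ℝ}
    (hv : ∀ i k, HasDerivAt (fun s => v s i k) (v' i k) t) (k : Fin d → Fin (N + 1)) :
    HasDerivAt (fun s => nodeDiv nd Ψ (v s) k) (nodeDiv nd Ψ v' k) t :=
  HasDerivAt.fun_sum fun j _ => hasDerivAt_nodeDiff (hv j) j k

lemma hasDerivAt_nodeObs {v : ℝ → Fin d → (Fin d → Fin (N + 1)) → ℝ}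
    {v' : Fin d → (Fin d → Fin (N + 1)) → ℝ}
    (hv : ∀ i k, HasDerivAt (fun s => v s i k) (v' i k) t) (lam mu : ℝ) (j i : Fin d)
    (k : Fin d → Fin (N + 1)) :
    HasDerivAt (fun s => nodeObs lam mu nd Ψ j (v s) i k) (nodeObs lam mu nd Ψ j v' i k) t :=
  ((hasDerivAt_nodeDiff (hasDerivAt_nodeDiff (hv i) j) j k).const_mul _).add
    ((hasDerivAt_nodeDiff (hasDerivAt_nodeDiv hv) j k).const_mul _)

lemma hasDerivAt_nodeInner_self {a : ℝ → (Fin d → Fin (N + 1)) → ℝ}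
    {a' : (Fin d → Fin (N + 1)) → ℝ} (ha : ∀ k, HasDerivAt (fun s => a s k) (a' k) t) :
    HasDerivAt (fun s => nodeInner Ψ (a s) (a s)) (2 * nodeInner Ψ (a t) a') t := by
  have h1 := HasDerivAt.fun_sum (u := univ) fun k (_ : k ∈ univ) =>
    (((ha k).mul (ha k)).const_mul (∏ j, lglW N Ψ (k j)))
  refine h1.congr_deriv ?_
  rw [nodeInner, mul_sum]
  refine sum_congr rfl fun k _ => ?_
  ring

lemma hasDerivAt_nodeEnergy {w v : ℝ → Fin d → (Fin d → Fin (N + 1)) → ℝ}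
    {w' v' : Fin d → (Fin d → Fin (N + 1)) → ℝ}
    (hw : ∀ i k, HasDerivAt (fun s => w s i k) (w' i k) t)
    (hv : ∀ i k, HasDerivAt (fun s => v s i k) (v' i k) t) (lam mu : ℝ) :
    HasDerivAt (fun s => nodeEnergy lam mu nd Ψ (w s) (v s))
      ((∑ i, nodeInner Ψ (w t i) (w' i)) +
        (mu * ∑ i, ∑ j, nodeInner Ψ (nodeDiff nd Ψ j (v t i)) (nodeDiff nd Ψ j (v' i)) +
          (lam + mu) * nodeInner Ψ (nodeDiv nd Ψ (v t)) (nodeDiv nd Ψ v'))) t := by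
  have h1 : HasDerivAt (fun s => ∑ i, nodeInner Ψ (w s i) (w s i))
      (∑ i, 2 * nodeInner Ψ (w t i) (w' i)) t :=
    HasDerivAt.fun_sum fun i _ => hasDerivAt_nodeInner_self (hw i)
  have h2 : HasDerivAt
      (fun s => ∑ i, ∑ j, nodeInner Ψ (nodeDiff nd Ψ j (v s i)) (nodeDiff nd Ψ j (v s i)))
      (∑ i, ∑ j, 2 * nodeInner Ψ (nodeDiff nd Ψ j (v t i)) (nodeDiff nd Ψ j (v' i))) t :=
    HasDerivAt.fun_sum fun i _ => HasDerivAt.fun_sum fun j _ =>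
      hasDerivAt_nodeInner_self (hasDerivAt_nodeDiff (hv i) j)
  have h3 := hasDerivAt_nodeInner_self (Ψ := Ψ) (hasDerivAt_nodeDiv (nd := nd) (Ψ := Ψ) hv)
  refine (((h1.add (h2.const_mul mu)).add (h3.const_mul (lam + mu))).const_mul
    (1 / 2)).congr_deriv ?_
  simp only [← mul_sum]
  ring

lemma IsLGL.mem_Icc (h : IsLGL N nd) (k : Fin (N + 1)) : nd k ∈ Set.Icc (-1 : ℝ) 1 :=
  ⟨h.2.1 ▸ h.1.monotone (Fin.zero_le k), h.2.2.1 ▸ h.1.monotone (Fin.le_last k)⟩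

lemma IsLGL.nodeP_mem_cubeB (h : IsLGL N nd) {k : Fin d → Fin (N + 1)}
    (hk : ∃ j, k j = 0 ∨ k j = Fin.last N) : nodeP nd k ∈ cubeB d := by
  refine ⟨fun j _ => h.mem_Icc (k j), fun hO => ?_⟩
  obtain ⟨j, hj | hj⟩ := hk
  · have := (hO j (Set.mem_univ j)).1
    rw [nodeP, hj, h.2.1] at this
    exact lt_irrefl _ this
  · have := (hO j (Set.mem_univ j)).2
    rw [nodeP, hj, h.2.2.1] at this
    exact lt_irrefl _ this

lemma IsLGL.nodeP_mem_cubeO (h : IsLGL N nd) {k : Fin d → Fin (N + 1)}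
    (hk : ¬∃ j, k j = 0 ∨ k j = Fin.last N) : nodeP nd k ∈ cubeO d := by
  intro j _
  push Not at hk
  constructor
  · rw [← h.2.1]
    exact h.1 (Fin.pos_iff_ne_zero.2 (hk j).1)
  · rw [← h.2.2.1]
    exact h.1 (Fin.lt_last_iff_ne_last.2 (hk j).2)

lemma HasDerivAt.eq_zero_of_eqOn_Icc {f : ℝ → ℝ} {f' T : ℝ} (hT : 0 < T)
    (ht : t ∈ Set.Icc 0 T) (hf : HasDerivAt f f' t) (h0 : ∀ s ∈ Set.Icc 0 T, f s = 0) :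
    f' = 0 :=
  (uniqueDiffOn_Icc hT t ht).eq_deriv _ hf.hasDerivWithinAt
    ((hasDerivWithinAt_const t _ (0 : ℝ)).congr h0 (h0 t ht))

section Solution

variable {lam mu T : ℝ} {φ : ℝ → Vec d → Fin d → ℝ}

lemma IsColloc.hasDerivAt (hφ : IsColloc d N lam mu T nd φ) (t : ℝ) (x : Vec d) (i : Fin d) :
    HasDerivAt (fun s => φ s x i) (tderiv φ t x i) t :=
  ((hφ.1 x i).differentiable (by simp) t).hasDerivAt

lemma IsColloc.hasDerivAt_tderiv (hφ : IsColloc d N lam mu T nd φ) (t : ℝ) (x : Vec d)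
    (i : Fin d) : HasDerivAt (fun s => tderiv φ s x i) (tderiv (tderiv φ) t x i) t := by
  have h1 : ContDiff ℝ (1 : ℕ∞) (deriv fun s => φ s x i) :=
    ((contDiff_infty_iff_deriv.1 (hφ.1 x i)).2).of_le (by exact_mod_cast le_top)
  exact (h1.differentiable (by simp) t).hasDerivAt

lemma IsColloc.eq_lagInterp (hφ : IsColloc d N lam mu T nd φ) (h : IsLGL N nd)
    (hΨ : IsLagrange N nd Ψ) (ht : t ∈ Set.Icc 0 T) (i : Fin d) :
    (fun x => φ t x i) = lagInterp Ψ fun k => φ t (nodeP nd k) i :=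
  (hφ.2.1 t ht i).eq_lagInterp h hΨ

lemma IsColloc.dEnergy_eq (hφ : IsColloc d N lam mu T nd φ) (h : IsLGL N nd)
    (hΨ : IsLagrange N nd Ψ) (ht : t ∈ Set.Icc 0 T) :
    dEnergy d N lam mu nd Ψ φ t = nodeEnergy lam mu nd Ψ
      (fun i k => tderiv φ t (nodeP nd k) i) (fun i k => φ t (nodeP nd k) i) := by
  have hu := hφ.eq_lagInterp h hΨ ht
  simp only [dEnergy, nodeEnergy, dInner, nodeInner, vdiv_eq_lagInterp h hΨ hu,
    lagInterp_nodeP hΨ]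
  simp only [hu, pd_lagInterp h hΨ, lagInterp_nodeP hΨ]

/-- Conservation of the discrete energy. -/
lemma IsColloc.nodeEnergy_eq (hφ : IsColloc d N lam mu T nd φ) (h : IsLGL N nd) (hN : 2 ≤ N)
    (hΨ : IsLagrange N nd Ψ) (hT : 0 < T) (ht : t ∈ Set.Icc 0 T) :
    nodeEnergy lam mu nd Ψ (fun i k => tderiv φ t (nodeP nd k) i)
      (fun i k => φ t (nodeP nd k) i) =
    nodeEnergy lam mu nd Ψ (fun i k => tderiv φ 0 (nodeP nd k) i)
      (fun i k => φ 0 (nodeP nd k) i) := by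
  have hE : ∀ s, HasDerivAt _ _ s := fun s =>
    hasDerivAt_nodeEnergy (nd := nd) (Ψ := Ψ) (t := s)
      (w := fun s i k => tderiv φ s (nodeP nd k) i) (v := fun s i k => φ s (nodeP nd k) i)
      (fun i k => hφ.hasDerivAt_tderiv s (nodeP nd k) i)
      (fun i k => hφ.hasDerivAt s (nodeP nd k) i) lam mu
  refine constant_of_has_deriv_right_zero
    (f := fun s => nodeEnergy lam mu nd Ψ (fun i k => tderiv φ s (nodeP nd k) i)
      (fun i k => φ s (nodeP nd k) i))
    (fun s _ => (hE s).continuousAt.continuousWithinAt) (fun s hs => ?_) t ht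
  have hs' : s ∈ Set.Icc 0 T := Set.Ico_subset_Icc_self hs
  refine ((hE s).congr_deriv ?_).hasDerivWithinAt
  have hbd : ∀ i (k : Fin d → Fin (N + 1)), (∃ j, k j = 0 ∨ k j = Fin.last N) →
      tderiv φ s (nodeP nd k) i = 0 := fun i k hk =>
    (hφ.hasDerivAt s (nodeP nd k) i).eq_zero_of_eqOn_Icc hT hs' fun r hr =>
      hφ.2.2.2 r hr k (h.nodeP_mem_cubeB hk) i
  have h1 := sum_nodeInner_nodeElast h hN hΨ lam mu (fun i k => φ s (nodeP nd k) i)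
    (fun i k => tderiv φ s (nodeP nd k) i) hbd
  have h2 : ∀ i, nodeInner Ψ (fun k => tderiv φ s (nodeP nd k) i)
      (fun k => tderiv (tderiv φ) s (nodeP nd k) i) =
      nodeInner Ψ (nodeElast lam mu nd Ψ (fun i k => φ s (nodeP nd k) i) i)
        (fun k => tderiv φ s (nodeP nd k) i) := by
    intro i
    refine sum_congr rfl fun k _ => ?_
    by_cases hk : ∃ j, k j = 0 ∨ k j = Fin.last N
    · simp only [hbd i k hk, zero_mul, mul_zero]
    · beta_reduce
      rw [hφ.2.2.1 s hs' k (h.nodeP_mem_cubeO hk) i,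
        elast_eq_nodeElast h hΨ (hφ.eq_lagInterp h hΨ hs')]
      ring
  rw [sum_congr rfl fun i _ => h2 i, h1]
  ring

lemma IsColloc.intervalIntegrable_faceInt (hφ : IsColloc d N lam mu T nd φ) (h : IsLGL N nd)
    (hΨ : IsLagrange N nd Ψ) (hT : 0 < T) (j : Fin d) :
    IntervalIntegrable (fun t => faceInt d j 1 fun x => ∑ i, (obs2 lam mu (φ t) j 1 x i) ^ 2)
      volume 0 T := by
  have hc : Continuous fun t => (1 / 2 : ℝ) * ∑ i, ∑ k, ∑ l,
      faceTrace j (nodeObs lam mu nd Ψ j (fun i k => φ t (nodeP nd k) i) i) k *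
        faceTrace j (nodeObs lam mu nd Ψ j (fun i k => φ t (nodeP nd k) i) i) l *
        (2 * ∏ i ∈ univ.erase j, polyInt (Ψ (k i) * Ψ (l i))) := by
    have ho : ∀ i k, Continuous fun t =>
        faceTrace j (nodeObs lam mu nd Ψ j (fun i k => φ t (nodeP nd k) i) i) k := by
      intro i k
      unfold faceTrace
      split_ifs
      · exact continuous_iff_continuousAt.2 fun t => (hasDerivAt_nodeObs
          (fun i k => hφ.hasDerivAt t (nodeP nd k) i) lam mu j i k).continuousAt
      · exact continuous_const
    exact continuous_const.mul <| continuous_finsetSum _ fun i _ => continuous_finsetSum _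
      fun k _ => continuous_finsetSum _ fun l _ => ((ho i k).mul (ho i l)).mul continuous_const
  refine (hc.continuousOn.congr fun t ht => ?_).intervalIntegrable
  rw [Set.uIcc_of_le hT.le] at ht
  simp only [faceInt, obs2_eq_lagInterp h hΨ (hφ.eq_lagInterp h hΨ ht)]
  rw [integral_finsetSum _ fun i _ => ?_]
  · simp only [integral_lagInterp_update_sq h hΨ]
  · refine Continuous.integrableOn_cubeC (((continuous_lagInterp Ψ _).comp ?_).pow 2)
    exact continuous_id.update j continuous_const

end Solution

end Evolution

end Tensor

/-- Estimate of the extra multiplier term coming from the face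
`Γ₁ = {x₁ = 1}`: for every `ε > 0` there is `C_ε > 0`, depending only on `ε`, such that
for every collocation solution `φ`,
`|∫₀ᵀ∫_Ω (Σ_{i∈I_{Γ₁}} (μ∂²φ/∂ν² + (λ+μ)ν ∂(div φ)/∂ν)(t,P_i) Ψ_i(x))·(m_j ∂φ/∂x_j)| ≤
 C_ε ω_N ∫₀ᵀ∫_{Γ₁}|μ∂²φ/∂ν² + (λ+μ)ν ∂(div φ)/∂ν|² + (8d/μ) ε T E(0)`,
with `ω_N = 2/(N(N+1))`. -/
theorem stmt11 : ∀ ε > (0 : ℝ), ∃ Cε > (0 : ℝ),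
    ∀ d : ℕ, ∀ hd : 2 ≤ d, ∀ lam mu : ℝ, 0 < lam → 0 < mu → ∀ N : ℕ, 2 ≤ N →
    ∀ T > (0 : ℝ), ∀ nd : Fin (N + 1) → ℝ, IsLGL N nd →
    ∀ Ψ : Fin (N + 1) → Polynomial ℝ, IsLagrange N nd Ψ →
    ∀ φ : ℝ → Vec d → Fin d → ℝ, IsColloc d N lam mu T nd φ →
      |∫ t in (0 : ℝ)..T, ∫ x in cubeO d, ∑ i,
          (∑ k ∈ Finset.univ.filter
              (fun k : Fin d → Fin (N + 1) =>
                nodeP nd k (⟨0, by omega⟩ : Fin d) = 1),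
            obs2 lam mu (φ t) (⟨0, by omega⟩ : Fin d) 1 (nodeP nd k) i *
              ∏ j, (Ψ (k j)).eval (x j)) *
          ∑ j, (x j + 1) * pd j (fun y => φ t y i) x| ≤
        Cε * (2 / ((N : ℝ) * ((N : ℝ) + 1))) *
          (∫ t in (0 : ℝ)..T, faceInt d (⟨0, by omega⟩ : Fin d) 1 fun x =>
            ∑ i, (obs2 lam mu (φ t) (⟨0, by omega⟩ : Fin d) 1 x i) ^ 2) +
        8 * (d : ℝ) / mu * ε * T * dEnergy d N lam mu nd Ψ φ 0 := by
  intro ε hε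
  refine ⟨1 / (4 * ε), by positivity, ?_⟩
  intro d hd lam mu hlam hmu N hN T hT nd h Ψ hΨ φ hφ
  have hint := hφ.intervalIntegrable_faceInt h hΨ hT ⟨0, by omega⟩
  rw [← Real.norm_eq_abs]
  refine (intervalIntegral.norm_integral_le_of_norm_le
    (g := fun t => 1 / (4 * ε) * (2 / ((N : ℝ) * ((N : ℝ) + 1))) *
        (faceInt d ⟨0, by omega⟩ 1 fun x => ∑ i, (obs2 lam mu (φ t) ⟨0, by omega⟩ 1 x i) ^ 2) +
      8 * (d : ℝ) / mu * ε * dEnergy d N lam mu nd Ψ φ 0)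
    hT.le (ae_of_all _ fun t ht => ?_)
    ((hint.const_mul _).add intervalIntegrable_const)).trans_eq ?_
  · have ht' : t ∈ Set.Icc 0 T := Set.Ioc_subset_Icc_self ht
    rw [Real.norm_eq_abs, hφ.dEnergy_eq h hΨ (Set.left_mem_Icc.2 hT.le),
      ← hφ.nodeEnergy_eq h hN hΨ hT ht']
    exact abs_setIntegral_face_multiplier_le h hN hΨ (hφ.eq_lagInterp h hΨ ht') hlam hmu _ _ hε
  · rw [intervalIntegral.integral_add (hint.const_mul _) intervalIntegrable_const,
      intervalIntegral.integral_const_mul, intervalIntegral.integral_const, smul_eq_mul]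
    ring

end
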